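/- arXiv:2512.01588 — 8 statements merged into one kernel-verified Lean document; each statement's English description precedes it below -/
import Mathlib

section
/- Let f = Σ_{i=0}^n f_i X^i ∈ ℤ[X] be a polynomial of degree n ≥ 1 with integer coefficients, and set ‖f‖_∞ = max_i |f_i|. If ω ∈ ℝ is a real root of f which is not an integer, then for every integer z ∈ ℤ one has |ω − z| > ((n+1)³ · 2^n · (2 + ‖f‖_∞)^n)⁻¹. -/
open Polynomial in
theorem aux_low (g : ℤ[X]) (hg : g ≠ 0) (d : ℝ) (hd : d ≠ 0) (hd1 : |d| ≤ 1)
    (h0 : aeval d g = 0) :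
    1 ≤ |d| * ∑ k ∈ Finset.range (g.natDegree + 1), |(g.coeff k : ℝ)| := by
  have hdp : 0 < |d| := abs_pos.mpr hd
  set m := g.natTrailingDegree with hm
  have hmm : m ∈ Finset.range (g.natDegree + 1) := by
    have := g.natTrailingDegree_le_natDegree
    simp; omega
  have hcm : (1 : ℝ) ≤ |(g.coeff m : ℝ)| := by
    have h1 : g.coeff m ≠ 0 := by
      have := trailingCoeff_nonzero_iff_nonzero.mpr hg
      exact this
    exact_mod_cast Int.one_le_abs h1
  rw [aeval_eq_sum_range, ← Finset.add_sum_erase _ _ hmm] at h0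
  simp only [zsmul_eq_mul] at h0
  have h2 : |(g.coeff m : ℝ)| * |d| ^ m ≤
      ∑ k ∈ (Finset.range (g.natDegree + 1)).erase m, |(g.coeff k : ℝ)| * |d| ^ (m + 1) := by
    rw [← abs_pow, ← abs_mul, eq_neg_of_add_eq_zero_left h0, abs_neg]
    refine (Finset.abs_sum_le_sum_abs _ _).trans (Finset.sum_le_sum fun k hk => ?_)
    rw [abs_mul, abs_pow]
    rcases lt_or_ge k m with h | h
    · simp [coeff_eq_zero_of_lt_natTrailingDegree h]
    · have : m + 1 ≤ k := by
        have := (Finset.mem_erase.mp hk).1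
        omega
      exact mul_le_mul_of_nonneg_left (pow_le_pow_of_le_one hdp.le hd1 this) (abs_nonneg _)
  have h3 : ∑ k ∈ (Finset.range (g.natDegree + 1)).erase m, |(g.coeff k : ℝ)| ≤
      ∑ k ∈ Finset.range (g.natDegree + 1), |(g.coeff k : ℝ)| :=
    Finset.sum_le_sum_of_subset_of_nonneg (Finset.erase_subset _ _) fun _ _ _ => abs_nonneg _
  rw [← Finset.sum_mul] at h2
  have h4 : 1 * |d| ^ m ≤
      (|d| * ∑ k ∈ Finset.range (g.natDegree + 1), |(g.coeff k : ℝ)|) * |d| ^ m := by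
    calc 1 * |d| ^ m ≤ |(g.coeff m : ℝ)| * |d| ^ m := by gcongr
      _ ≤ _ := h2
      _ ≤ (∑ k ∈ Finset.range (g.natDegree + 1), |(g.coeff k : ℝ)|) * |d| ^ (m + 1) := by gcongr
      _ = _ := by ring
  exact le_of_mul_le_mul_right h4 (by positivity)

open Polynomial in
theorem aux_taylor (f : ℤ[X]) (z : ℤ) :
    ∑ k ∈ Finset.range (f.natDegree + 1), |((taylor z f).coeff k : ℝ)| ≤
      ∑ i ∈ Finset.range (f.natDegree + 1), |(f.coeff i : ℝ)| * (1 + |(z : ℝ)|) ^ i := by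
  have hc : ∀ k, ((taylor z f).coeff k : ℝ) = ∑ i ∈ Finset.range (f.natDegree + 1),
      (f.coeff i : ℝ) * ((z : ℝ) ^ (i - k) * (i.choose k : ℝ)) := by
    intro k
    rw [taylor_apply, comp, eval₂_eq_sum_range, finsetSum_coeff]
    simp only [coeff_C_mul, coeff_X_add_C_pow]
    push_cast
    rfl
  calc _ ≤ ∑ k ∈ Finset.range (f.natDegree + 1), ∑ i ∈ Finset.range (f.natDegree + 1),
      |(f.coeff i : ℝ)| * (|(z : ℝ)| ^ (i - k) * (i.choose k : ℝ)) := by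
        refine Finset.sum_le_sum fun k _ => ?_
        rw [hc]
        refine (Finset.abs_sum_le_sum_abs _ _).trans (le_of_eq ?_)
        simp [abs_mul]
    _ = _ := by
        rw [Finset.sum_comm]
        refine Finset.sum_congr rfl fun i hi => ?_
        rw [← Finset.mul_sum, add_pow]
        congr 1
        symm
        simp only [one_pow, one_mul]
        refine Finset.sum_subset (fun x hx => ?_) (fun x _ hx => ?_)
        · simp at *; omega
        · rw [Nat.choose_eq_zero_of_lt (by simpa using hx)]; simp

theorem aux_geom (c : ℕ → ℝ) (n : ℕ) (H x : ℝ) (hx : 1 ≤ x)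
    (hc : ∀ i < n, |c i| ≤ H) :
    (∑ i ∈ Finset.range n, |c i| * x ^ i) * (x - 1) ≤ H * (x ^ n - 1) := by
  rw [← geom_sum_mul, ← mul_assoc, Finset.mul_sum]
  refine mul_le_mul_of_nonneg_right (Finset.sum_le_sum fun i hi => ?_) (by linarith)
  exact mul_le_mul_of_nonneg_right (hc i (Finset.mem_range.mp hi)) (by positivity)

open Polynomial in
theorem aux_cauchy (f : ℤ[X]) (w H : ℝ) (hH : 0 ≤ H) (hroot : aeval w f = 0)
    (hc : ∀ i, |(f.coeff i : ℝ)| ≤ H) :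
    |(f.coeff f.natDegree : ℝ)| * |w| ≤ |(f.coeff f.natDegree : ℝ)| + H := by
  rcases le_or_gt |w| 1 with h | h
  · nlinarith [abs_nonneg (f.coeff f.natDegree : ℝ)]
  · rw [aeval_eq_sum_range, Finset.sum_range_succ] at hroot
    simp only [zsmul_eq_mul] at hroot
    have h1 : |(f.coeff f.natDegree : ℝ)| * |w| ^ f.natDegree ≤
        ∑ i ∈ Finset.range f.natDegree, |(f.coeff i : ℝ)| * |w| ^ i := by
      rw [← abs_pow, ← abs_mul, eq_neg_of_add_eq_zero_right hroot, abs_neg]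
      refine (Finset.abs_sum_le_sum_abs _ _).trans (le_of_eq ?_)
      simp [abs_mul]
    have h2 := aux_geom (fun i => (f.coeff i : ℝ)) f.natDegree H |w| h.le (fun i _ => hc i)
    have h3 := mul_le_mul_of_nonneg_right h1 (sub_nonneg.mpr h.le)
    have hp : 0 < |w| ^ f.natDegree := by positivity
    have h4 : (|(f.coeff f.natDegree : ℝ)| * (|w| - 1)) * |w| ^ f.natDegree ≤
        H * |w| ^ f.natDegree := by
      nlinarith
    have := le_of_mul_le_mul_right h4 hp
    linarith

/-- **Liouville's lemma**: if `ω` is a real root of a polynomial `f ∈ ℤ[X]` of degree `n ≥ 1`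
and `ω` is not an integer, then for every integer `z`,
`|ω − z| > ((n+1)³ · 2^n · (2 + ‖f‖_∞)^n)⁻¹`, where `‖f‖_∞` is the maximum of the
absolute values of the coefficients of `f`. -/
theorem liouville_lemma (f : Polynomial ℤ) (hdeg : 1 ≤ f.natDegree) (ω : ℝ)
    (hroot : Polynomial.aeval ω f = 0) (hω : ∀ k : ℤ, ω ≠ (k : ℝ)) (z : ℤ) :
    (((f.natDegree : ℝ) + 1) ^ 3 * 2 ^ f.natDegree *
          (2 + (((Finset.range (f.natDegree + 1)).sup fun i => (f.coeff i).natAbs : ℕ) : ℝ)) ^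
            f.natDegree)⁻¹ <
      |ω - (z : ℝ)| := by
  have hf0 : f ≠ 0 := by rintro rfl; simp at hdeg
  set N : ℕ := (Finset.range (f.natDegree + 1)).sup fun i => (f.coeff i).natAbs with hN
  have hcN : ∀ i, (f.coeff i).natAbs ≤ N := by
    intro i
    rcases lt_or_ge f.natDegree i with h | h
    · simp [Polynomial.coeff_eq_zero_of_natDegree_lt h]
    · exact Finset.le_sup (f := fun i => (f.coeff i).natAbs) (by simp; omega)
  have hc : ∀ i, |(f.coeff i : ℝ)| ≤ (N : ℝ) := by
    intro i
    have h1 : |(f.coeff i : ℝ)| = ((f.coeff i).natAbs : ℝ) := by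
      rw [Nat.cast_natAbs]; push_cast; rfl
    rw [h1]; exact_mod_cast hcN i
  have hA1 : (1 : ℝ) ≤ |(f.coeff f.natDegree : ℝ)| := by
    have h1 : f.coeff f.natDegree ≠ 0 := by simpa using hf0
    exact_mod_cast Int.one_le_abs h1
  have hcau := aux_cauchy f ω N (by positivity) hroot hc
  have hAN := hc f.natDegree
  have htay := aux_taylor f z
  rw [Finset.sum_range_succ (fun i => |(f.coeff i : ℝ)| * (1 + |(z : ℝ)|) ^ i)] at htay
  have hgeo : ∀ x : ℝ, 1 ≤ x → _ := fun x hx =>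
    aux_geom (fun i => (f.coeff i : ℝ)) f.natDegree N x hx (fun i _ => hc i)
  have hg0 : Polynomial.taylor z f ≠ 0 := by
    intro h; exact hf0 ((Polynomial.taylor_injective z) (by simpa using h))
  have hgr : Polynomial.aeval (ω - z) (Polynomial.taylor z f) = 0 := by
    rw [Polynomial.taylor_apply, Polynomial.aeval_comp]
    simpa using hroot
  have hd0 : ω - z ≠ 0 := sub_ne_zero.mpr (hω z)
  have hlow := aux_low _ hg0 (ω - z) hd0
  rw [Polynomial.natDegree_taylor] at hlow
  obtain ⟨n, hn⟩ : ∃ n, f.natDegree = n + 1 := ⟨f.natDegree - 1, by omega⟩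
  generalize hA : |(f.coeff f.natDegree : ℝ)| = A at *
  generalize hS : ∑ k ∈ Finset.range (f.natDegree + 1),
    |((Polynomial.taylor z f).coeff k : ℝ)| = S at *
  have hN1 : (1 : ℝ) ≤ N := hA1.trans hAN
  have hD : 16 * (2 + (N : ℝ)) ^ f.natDegree ≤ ((f.natDegree : ℝ) + 1) ^ 3 * 2 ^ f.natDegree *
      (2 + (N : ℝ)) ^ f.natDegree := by
    have h1 : (1 : ℝ) ≤ f.natDegree := by exact_mod_cast hdeg
    have h2 : (2 : ℝ) ^ 3 ≤ ((f.natDegree : ℝ) + 1) ^ 3 := by gcongr; linarith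
    have h3 : (2 : ℝ) ^ 1 ≤ 2 ^ f.natDegree := pow_le_pow_right₀ (by norm_num) hdeg
    refine mul_le_mul_of_nonneg_right ?_ (by positivity)
    nlinarith
  generalize ((f.natDegree : ℝ) + 1) ^ 3 * 2 ^ f.natDegree *
      (2 + (N : ℝ)) ^ f.natDegree = D at *
  have hP1 : 1 ≤ (2 + (N : ℝ)) ^ f.natDegree := one_le_pow₀ (by linarith)
  have hDpos : 0 < D := by linarith
  rw [inv_lt_iff_one_lt_mul₀' hDpos]
  rcases le_or_gt 1 |ω - z| with h | h
  · nlinarith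
  have hlow := hlow h.le hgr
  have hw : |ω| ≤ 1 + N := by nlinarith [abs_nonneg ω]
  have hzw : |(z : ℝ)| < |ω| + 1 := by
    have := abs_sub_abs_le_abs_sub (z : ℝ) ω
    rw [abs_sub_comm] at this
    linarith
  have hz : |(z : ℝ)| ≤ 1 + N := by
    have h1 : ((|z| : ℤ) : ℝ) < ((2 + N : ℤ) : ℝ) := by push_cast; linarith
    have h2 : |z| < 2 + (N : ℤ) := by exact_mod_cast h1
    have h3 : |z| ≤ 1 + (N : ℤ) := by omega
    exact_mod_cast h3
  have hz2 : 1 + |(z : ℝ)| ≤ 2 + N := by linarith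
  have hS1 : S ≤ 5 * (2 + (N : ℝ)) ^ f.natDegree := by
    have e1 := hgeo (2 + N) (by linarith)
    have e2 : ∑ i ∈ Finset.range f.natDegree, |(f.coeff i : ℝ)| * (1 + |(z : ℝ)|) ^ i ≤
        ∑ i ∈ Finset.range f.natDegree, |(f.coeff i : ℝ)| * (2 + (N : ℝ)) ^ i := by
      gcongr 1 with i hi
      exact mul_le_mul_of_nonneg_left (pow_le_pow_left₀ (by positivity) hz2 i) (abs_nonneg _)
    generalize ∑ i ∈ Finset.range f.natDegree, |(f.coeff i : ℝ)| * (2 + (N : ℝ)) ^ i = T at *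
    have e3 : T ≤ (2 + (N : ℝ)) ^ f.natDegree := by nlinarith
    have e4 : A * (1 + |(z : ℝ)|) ≤ 4 * N := by nlinarith
    have e5 : A * (1 + |(z : ℝ)|) ^ f.natDegree ≤ 4 * (2 + (N : ℝ)) ^ f.natDegree := by
      rw [hn]
      calc A * (1 + |(z : ℝ)|) ^ (n + 1) = (A * (1 + |(z : ℝ)|)) * (1 + |(z : ℝ)|) ^ n := by ring
        _ ≤ (4 * (2 + N)) * (2 + (N : ℝ)) ^ n := by
            refine mul_le_mul (by linarith) (pow_le_pow_left₀ (by positivity) hz2 n)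
              (by positivity) (by positivity)
        _ = _ := by ring
    linarith
  have hdp : 0 < |ω - z| := abs_pos.mpr hd0
  nlinarith
end

section
/- For every real number x ≥ 2 one has log x ≤ ∏_{p prime, p < x} (1 − 1/p)⁻¹ ≤ 6 · log x, where the product ranges over all prime numbers strictly less than x. -/
/-- `n ↦ n^(-s)` as a monoid homomorphism. -/
noncomputable def mtbHom (s : ℝ) : ℕ →* ℝ where
  toFun n := (n : ℝ) ^ (-s)
  map_one' := by simp
  map_mul' m n := by
    push_cast
    exact Real.mul_rpow (Nat.cast_nonneg m) (Nat.cast_nonneg n)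

lemma mtbHom_apply (s : ℝ) (n : ℕ) : mtbHom s n = (n : ℝ) ^ (-s) := rfl

lemma mtb_hasSum (s : ℝ) (hs : 0 < s) (N : ℕ) :
    HasSum (fun m : N.smoothNumbers ↦ (((m : ℕ) : ℝ) ^ (-s)))
      (∏ p ∈ N.primesBelow, (1 - (p : ℝ) ^ (-s))⁻¹) := by
  refine (EulerProduct.summable_and_hasSum_smoothNumbers_prod_primesBelow_geometric
    (f := mtbHom s) ?_ N).2
  intro p hp
  rw [mtbHom_apply, Real.norm_of_nonneg (by positivity)]
  exact Real.rpow_lt_one_of_one_lt_of_neg (by exact_mod_cast hp.one_lt) (by linarith)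

lemma mtb_lower (N : ℕ) (hN : 1 ≤ N) :
    Real.log N ≤ ∏ p ∈ N.primesBelow, (1 - 1 / (p : ℝ))⁻¹ := by
  have h := mtb_hasSum 1 one_pos N
  simp only [Real.rpow_neg_one] at h
  simp only [one_div]
  obtain ⟨n, rfl⟩ : ∃ n, N = n + 1 := ⟨N - 1, by omega⟩
  refine (log_add_one_le_harmonic n).trans ?_
  rw [harmonic_eq_sum_Icc]
  push_cast
  have h2 := sum_le_hasSum (Finset.subtype (· ∈ (n + 1).smoothNumbers) (Finset.Icc 1 n))
    (fun i _ => by positivity) h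
  refine le_trans (le_of_eq ?_) h2
  rw [Finset.sum_subtype_of_mem (fun i : ℕ => (i : ℝ)⁻¹)]
  intro m hm
  rw [Finset.mem_Icc] at hm
  exact Nat.mem_smoothNumbers_of_lt (by omega) (by omega)

lemma mtb_zeta_step (d : ℝ) (hd : 0 < d) (n : ℕ) (hn : 1 ≤ n) :
    d * ((n + 1 : ℕ) : ℝ) ^ (-(1 + d)) ≤ (n : ℝ) ^ (-d) - ((n + 1 : ℕ) : ℝ) ^ (-d) := by
  have hn0 : (0 : ℝ) < n := by exact_mod_cast hn
  have hn1 : (0 : ℝ) < ((n + 1 : ℕ) : ℝ) := by positivity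
  have hlog : 1 / ((n + 1 : ℕ) : ℝ) ≤ Real.log ((n + 1 : ℕ) : ℝ) - Real.log n := by
    have := Real.one_sub_inv_le_log_of_pos (x := ((n + 1 : ℕ) : ℝ) / n) (by positivity)
    rw [Real.log_div (by positivity) (by positivity)] at this
    refine le_trans (le_of_eq ?_) this
    push_cast
    field_simp
    ring
  have h1 : (n : ℝ) ^ (-d) = ((n + 1 : ℕ) : ℝ) ^ (-d) *
      Real.exp (d * (Real.log ((n + 1 : ℕ) : ℝ) - Real.log n)) := by
    rw [Real.rpow_def_of_pos hn0, Real.rpow_def_of_pos hn1, ← Real.exp_add]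
    congr 1
    ring
  have h2 : ((n + 1 : ℕ) : ℝ) ^ (-(1 + d)) =
      ((n + 1 : ℕ) : ℝ) ^ (-d) * (1 / ((n + 1 : ℕ) : ℝ)) := by
    rw [show -(1 + d) = -d + -1 by ring, Real.rpow_add hn1, Real.rpow_neg_one, one_div]
  rw [h1, h2]
  have h3 := Real.add_one_le_exp (d * (Real.log ((n + 1 : ℕ) : ℝ) - Real.log n))
  have h4 : d * (1 / ((n + 1 : ℕ) : ℝ)) ≤
      Real.exp (d * (Real.log ((n + 1 : ℕ) : ℝ) - Real.log n)) - 1 := by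
    have := mul_le_mul_of_nonneg_left hlog hd.le
    linarith
  have h5 : (0 : ℝ) ≤ ((n + 1 : ℕ) : ℝ) ^ (-d) := by positivity
  nlinarith [mul_le_mul_of_nonneg_left h4 h5]

lemma mtb_zeta_partial (d : ℝ) (hd : 0 < d) (M : ℕ) :
    d * ∑ n ∈ Finset.Icc 1 (M + 1), (n : ℝ) ^ (-(1 + d)) ≤
      d + 1 - ((M + 1 : ℕ) : ℝ) ^ (-d) := by
  induction M with
  | zero => simp
  | succ M ih =>
    rw [Finset.sum_Icc_succ_top (by omega), mul_add]
    have := mtb_zeta_step d hd (M + 1) (by omega)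
    linarith

lemma mtb_euler_le (d : ℝ) (hd : 0 < d) (N : ℕ) :
    ∏ p ∈ N.primesBelow, (1 - (p : ℝ) ^ (-(1 + d)))⁻¹ ≤ 1 + 1 / d := by
  refine hasSum_le_of_sum_le (mtb_hasSum (1 + d) (by linarith) N) ?_
  intro s
  have h1 : ∑ i ∈ s, ((i : ℕ) : ℝ) ^ (-(1 + d)) =
      ∑ n ∈ s.map (Function.Embedding.subtype _), (n : ℝ) ^ (-(1 + d)) := by
    rw [Finset.sum_map]; rfl
  rw [h1]
  set t := s.map (Function.Embedding.subtype _) with ht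
  have h2 : t ⊆ Finset.Icc 1 (t.sup id + 1) := by
    intro n hn
    have h3 : n ≤ t.sup id := Finset.le_sup (f := id) hn
    rw [ht, Finset.mem_map] at hn
    obtain ⟨a, _, rfl⟩ := hn
    have := Nat.ne_zero_of_mem_smoothNumbers a.2
    rw [Finset.mem_Icc]
    refine ⟨Nat.one_le_iff_ne_zero.mpr this, by omega⟩
  have h4 := Finset.sum_le_sum_of_subset_of_nonneg (f := fun n : ℕ => (n : ℝ) ^ (-(1 + d))) h2
    (fun i _ _ => by positivity)
  refine h4.trans ?_
  have h5 := mtb_zeta_partial d hd (t.sup id)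
  have h6 : (0 : ℝ) ≤ ((t.sup id + 1 : ℕ) : ℝ) ^ (-d) := by positivity
  have : 1 + 1 / d = (d + 1) / d := by field_simp
  rw [this, le_div_iff₀ hd]
  linarith

lemma mtb_factor (d : ℝ) (hd : 0 < d) (p : ℕ) (hp : 2 ≤ p) :
    (1 - 1 / (p : ℝ))⁻¹ ≤
      (1 - (p : ℝ) ^ (-(1 + d)))⁻¹ * Real.exp (d * (Real.log p / (p - 1))) := by
  have hp2 : (2 : ℝ) ≤ p := by exact_mod_cast hp
  have hp0 : (0 : ℝ) < p := by linarith
  have hu : (0 : ℝ) < 1 - 1 / (p : ℝ) := by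
    rw [sub_pos, div_lt_one hp0]; linarith
  have hv : (p : ℝ) ^ (-(1 + d)) < 1 :=
    Real.rpow_lt_one_of_one_lt_of_neg (by linarith) (by linarith)
  have h2 : (p : ℝ) ^ (-(1 + d)) = (p : ℝ) ^ (-d) * (1 / p) := by
    rw [show -(1 + d) = -d + -1 by ring, Real.rpow_add hp0, Real.rpow_neg_one, one_div]
  have h3 : 1 - d * Real.log p ≤ (p : ℝ) ^ (-d) := by
    rw [Real.rpow_def_of_pos hp0]
    have := Real.add_one_le_exp (Real.log p * -d)
    linarith
  have h4 := Real.add_one_le_exp (d * (Real.log p / (p - 1)))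
  rw [inv_mul_eq_div, le_div_iff₀ (by linarith), inv_mul_eq_div, div_le_iff₀ hu]
  refine le_trans ?_ (mul_le_mul_of_nonneg_right h4 hu.le)
  have h5 : (d * (Real.log p / (p - 1)) + 1) * (1 - 1 / (p : ℝ)) =
      d * Real.log p * (1 / p) + 1 - 1 / p := by
    have : (p : ℝ) - 1 ≠ 0 := by linarith
    field_simp
    ring
  rw [h5, h2]
  have : (0 : ℝ) < 1 / p := by positivity
  nlinarith [mul_le_mul_of_nonneg_right h3 this.le]

lemma mtb_prod_le (d : ℝ) (hd : 0 < d) (N : ℕ) :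
    ∏ p ∈ N.primesBelow, (1 - 1 / (p : ℝ))⁻¹ ≤
      (1 + 1 / d) * Real.exp (d * ∑ p ∈ N.primesBelow, Real.log p / ((p : ℝ) - 1)) := by
  calc _ ≤ ∏ p ∈ N.primesBelow,
        ((1 - (p : ℝ) ^ (-(1 + d)))⁻¹ * Real.exp (d * (Real.log p / (p - 1)))) := by
        refine Finset.prod_le_prod ?_ ?_
        · intro p hp
          have hp2 : (2 : ℝ) ≤ p := by
            exact_mod_cast (Nat.prime_of_mem_primesBelow hp).two_le
          rw [inv_nonneg, sub_nonneg, div_le_one (by linarith)]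
          linarith
        · intro p hp
          exact mtb_factor d hd p (Nat.prime_of_mem_primesBelow hp).two_le
    _ = (∏ p ∈ N.primesBelow, (1 - (p : ℝ) ^ (-(1 + d)))⁻¹) *
        Real.exp (d * ∑ p ∈ N.primesBelow, Real.log p / ((p : ℝ) - 1)) := by
        rw [Finset.prod_mul_distrib, Finset.mul_sum, Real.exp_sum]
    _ ≤ _ := mul_le_mul_of_nonneg_right (mtb_euler_le d hd N) (Real.exp_pos _).le

lemma mtb_prod_dvd (n : ℕ) : ∏ p ∈ n.primesLE, p ^ (n / p) ∣ n.factorial := by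
  refine Finset.prod_dvd_of_isRelPrime ?_ ?_
  · intro p hp q hq hpq
    have hp := Nat.prime_of_mem_primesLE (Finset.mem_coe.mp hp)
    have hq := Nat.prime_of_mem_primesLE (Finset.mem_coe.mp hq)
    exact Nat.coprime_iff_isRelPrime.mp
      (Nat.Coprime.pow _ _ ((Nat.coprime_primes hp hq).mpr hpq))
  · intro p hp
    have hp := Nat.prime_of_mem_primesLE hp
    rw [Nat.Prime.pow_dvd_factorial_iff hp (b := Nat.log p n + 2) (by omega)]
    have := Finset.single_le_sum (f := fun i => n / p ^ i) (s := Finset.Ico 1 (Nat.log p n + 2))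
      (fun i _ => Nat.zero_le _) (Finset.mem_Ico.mpr ⟨le_refl 1, by omega⟩)
    simpa using this

lemma mtb_sum_log_div (n : ℕ) (hn : 1 ≤ n) :
    ∑ p ∈ n.primesLE, Real.log p / (p : ℝ) ≤ Real.log n + Real.log 4 := by
  have hn0 : (0 : ℝ) < n := by exact_mod_cast hn
  have h1 : ∏ p ∈ n.primesLE, p ^ (n / p) ≤ n ^ n :=
    (Nat.le_of_dvd (Nat.factorial_pos n) (mtb_prod_dvd n)).trans (Nat.factorial_le_pow n)
  have hpos : ∀ p ∈ n.primesLE, (0 : ℝ) < p := fun p hp => by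
    exact_mod_cast (Nat.prime_of_mem_primesLE hp).pos
  have h2 : ∑ p ∈ n.primesLE, ((n / p : ℕ) : ℝ) * Real.log p ≤ n * Real.log n := by
    have h3 : (∏ p ∈ n.primesLE, (p : ℝ) ^ (n / p)) ≤ (n : ℝ) ^ n := by exact_mod_cast h1
    have h4 := Real.log_le_log (Finset.prod_pos fun p hp => pow_pos (hpos p hp) _) h3
    rw [Real.log_prod (fun p hp => (pow_pos (hpos p hp) _).ne'), Real.log_pow] at h4
    simpa only [Real.log_pow] using h4
  have h5 : ∑ p ∈ n.primesLE, Real.log p ≤ Real.log 4 * n := by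
    have := Chebyshev.theta_le_log4_mul_x (x := n) hn0.le
    rwa [Chebyshev.theta_eq_sum_primesLE_log] at this
  have h6 : (n : ℝ) * ∑ p ∈ n.primesLE, Real.log p / (p : ℝ) ≤
      ∑ p ∈ n.primesLE, ((n / p : ℕ) : ℝ) * Real.log p + ∑ p ∈ n.primesLE, Real.log p := by
    rw [Finset.mul_sum, ← Finset.sum_add_distrib]
    refine Finset.sum_le_sum fun p hp => ?_
    have hp0 := hpos p hp
    have hl : 0 ≤ Real.log p := Real.log_natCast_nonneg p
    have h7 : (n : ℝ) / p ≤ ((n / p : ℕ) : ℝ) + 1 := by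
      rw [← Nat.floor_div_eq_div (K := ℝ)]
      exact (Nat.lt_floor_add_one _).le
    calc (n : ℝ) * (Real.log p / p) = (n / p) * Real.log p := by ring
      _ ≤ (((n / p : ℕ) : ℝ) + 1) * Real.log p := mul_le_mul_of_nonneg_right h7 hl
      _ = _ := by ring
  have h8 : (n : ℝ) * ∑ p ∈ n.primesLE, Real.log p / (p : ℝ) ≤
      n * (Real.log n + Real.log 4) := by linarith
  exact le_of_mul_le_mul_left h8 hn0

lemma mtb_tail (n : ℕ) :
    ∑ k ∈ Finset.Icc 2 (n + 1), Real.log k / ((k : ℝ) * (k - 1)) ≤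
      2 - (Real.log ((n + 1 : ℕ) : ℝ) + 2) / ((n + 1 : ℕ) : ℝ) := by
  induction n with
  | zero => simp
  | succ n ih =>
    rw [Finset.sum_Icc_succ_top (by omega)]
    set a : ℝ := ((n + 1 : ℕ) : ℝ) with ha
    have ha1 : 1 ≤ a := by rw [ha]; push_cast; linarith [Nat.cast_nonneg (α := ℝ) n]
    have hb : ((n + 1 + 1 : ℕ) : ℝ) = a + 1 := by rw [ha]; push_cast; ring
    rw [hb]
    have hlog : Real.log (a + 1) - Real.log a ≤ 1 / a := by
      have := Real.log_le_sub_one_of_pos (x := (a + 1) / a) (by positivity)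
      rw [Real.log_div (by positivity) (by positivity)] at this
      refine this.trans (le_of_eq ?_)
      field_simp
      ring
    have key : Real.log (a + 1) / ((a + 1) * (a + 1 - 1)) ≤
        (Real.log a + 2) / a - (Real.log (a + 1) + 2) / (a + 1) := by
      have h0 : (a + 1) * (Real.log (a + 1) - Real.log a) ≤ 2 := by
        calc _ ≤ (a + 1) * (1 / a) := mul_le_mul_of_nonneg_left hlog (by linarith)
          _ ≤ 2 := by
            rw [mul_one_div, div_le_iff₀ (by linarith)]; linarith
      rw [div_sub_div _ _ (by positivity) (by positivity), add_sub_cancel_right,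
        mul_comm (a + 1) a]
      refine div_le_div_of_nonneg_right ?_ (by positivity)
      nlinarith
    linarith

lemma mtb_sum (n : ℕ) (hn : 1 ≤ n) :
    ∑ p ∈ n.primesLE, Real.log p / ((p : ℝ) - 1) ≤ Real.log n + Real.log 4 + 2 := by
  have h1 : ∑ p ∈ n.primesLE, Real.log p / ((p : ℝ) - 1) =
      ∑ p ∈ n.primesLE, Real.log p / (p : ℝ) +
      ∑ p ∈ n.primesLE, Real.log p / ((p : ℝ) * (p - 1)) := by
    rw [← Finset.sum_add_distrib]
    refine Finset.sum_congr rfl fun p hp => ?_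
    have hp2 : (2 : ℝ) ≤ p := by
      exact_mod_cast (Nat.prime_of_mem_primesLE hp).two_le
    have h1 : (p : ℝ) - 1 ≠ 0 := by linarith
    have h2 : (p : ℝ) ≠ 0 := by linarith
    field_simp
    ring
  have h2 : ∑ p ∈ n.primesLE, Real.log p / ((p : ℝ) * (p - 1)) ≤ 2 := by
    obtain ⟨m, rfl⟩ : ∃ m, n = m + 1 := ⟨n - 1, by omega⟩
    have h3 : (m + 1).primesLE ⊆ Finset.Icc 2 (m + 1) := by
      intro p hp
      rw [Nat.mem_primesLE] at hp
      exact Finset.mem_Icc.mpr ⟨hp.2.two_le, hp.1⟩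
    have h4 := Finset.sum_le_sum_of_subset_of_nonneg
      (f := fun k : ℕ => Real.log k / ((k : ℝ) * (k - 1))) h3 (fun k hk _ => by
        have : (2 : ℝ) ≤ k := by exact_mod_cast (Finset.mem_Icc.mp hk).1
        exact div_nonneg (Real.log_natCast_nonneg k) (mul_nonneg (by linarith) (by linarith)))
    have h5 : 0 ≤ (Real.log ((m + 1 : ℕ) : ℝ) + 2) / ((m + 1 : ℕ) : ℝ) :=
      div_nonneg (by linarith [Real.log_natCast_nonneg (m + 1)]) (Nat.cast_nonneg _)
    linarith [mtb_tail m]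
  linarith [mtb_sum_log_div n hn]

lemma mtb_exp : Real.exp (81 / 50 : ℝ) ≤ 5.06 := by
  have h1 := Real.exp_bound' (x := 31 / 50) (by norm_num) (by norm_num) (n := 6) (by norm_num)
  have h2 := Real.exp_one_lt_d9
  have h3 : Real.exp (31 / 50 : ℝ) ≤ 1.8593 := by
    refine h1.trans ?_
    norm_num [Finset.sum_range_succ, Nat.factorial]
  rw [show (81 / 50 : ℝ) = 1 + 31 / 50 by norm_num, Real.exp_add]
  nlinarith [Real.exp_pos (31 / 50 : ℝ), Real.exp_pos (1 : ℝ)]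

/-- the product for large `x`, in terms of `N = ⌈x⌉` -/
lemma mtb_upper_large (x : ℝ) (hx : 256 ≤ x) (N : ℕ) (hN : N ≠ 0) (hNx : ((N - 1 : ℕ) : ℝ) ≤ x)
    (hN2 : 2 ≤ N) :
    ∏ p ∈ N.primesBelow, (1 - 1 / (p : ℝ))⁻¹ ≤ 6 * Real.log x := by
  set L := Real.log x with hL
  have hl2 := Real.log_two_gt_d9
  have hl2' := Real.log_two_lt_d9
  have hL5 : 5.545 ≤ L := by
    have : Real.log 256 ≤ L := Real.log_le_log (by norm_num) hx
    rw [show (256 : ℝ) = 2 ^ 8 by norm_num, Real.log_pow] at this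
    push_cast at this
    linarith
  have hl4 : Real.log 4 ≤ 1.3863 := by
    rw [show (4 : ℝ) = 2 ^ 2 by norm_num, Real.log_pow]
    push_cast
    linarith
  have h1 := mtb_prod_le (1 / L) (by positivity) N
  have h2 := mtb_sum (N - 1) (by omega)
  have h3 : Real.log ((N - 1 : ℕ) : ℝ) ≤ L :=
    Real.log_le_log (by exact_mod_cast (by omega : 0 < N - 1)) hNx
  have h4 : (N - 1).primesLE = N.primesBelow := by
    ext p
    rw [Nat.mem_primesLE, Nat.mem_primesBelow]
    have : p ≤ N - 1 ↔ p < N := by omega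
    rw [this]
  rw [h4] at h2
  have h5 : 1 / L * ∑ p ∈ N.primesBelow, Real.log p / ((p : ℝ) - 1) ≤ 81 / 50 := by
    rw [one_div, inv_mul_le_iff₀ (by linarith)]
    linarith
  have h6 := (Real.exp_le_exp.mpr h5).trans mtb_exp
  refine h1.trans ?_
  rw [one_div_one_div]
  calc (1 + L) * _ ≤ (1 + L) * 5.06 := mul_le_mul_of_nonneg_left h6 (by linarith)
    _ ≤ 6 * L := by linarith

/-- a decidable superset of the primes below `N` (for `N ≤ 256` it is exactly the primes) -/
def mtbSet (N : ℕ) : Finset ℕ :=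
  (Finset.range N).filter fun n =>
    n ∈ [2, 3, 5, 7, 11, 13] ∨ (n ≠ 1 ∧ Nat.gcd n 30030 = 1)

lemma mtb_small (N M c d : ℕ) (hNM : N ≤ M) (hd : 0 < d)
    (h : d * ∏ p ∈ mtbSet M, p ≤ c * ∏ p ∈ mtbSet M, (p - 1)) :
    ∏ p ∈ N.primesBelow, (1 - 1 / (p : ℝ))⁻¹ ≤ c / d := by
  have hge : ∀ p ∈ mtbSet M, 2 ≤ p := by
    intro p hp
    rw [mtbSet, Finset.mem_filter] at hp
    rcases hp.2 with h | h
    · simp only [List.mem_cons, List.not_mem_nil, or_false] at h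
      omega
    · have : p ≠ 0 := by rintro rfl; simp at h
      omega
  have hsub : N.primesBelow ⊆ mtbSet M := by
    intro p hp
    rw [Nat.mem_primesBelow] at hp
    rw [mtbSet, Finset.mem_filter, Finset.mem_range]
    refine ⟨by omega, ?_⟩
    by_cases h : p ∣ 30030
    · left
      have h30 : (30030 : ℕ) = 2 * (3 * (5 * (7 * (11 * 13)))) := by norm_num
      have e : ∀ q : ℕ, q.Prime → p ∣ q → p = q := fun q hq hpq =>
        (Nat.prime_dvd_prime_iff_eq hp.2 hq).mp hpq
      rw [h30] at h
      simp only [hp.2.dvd_mul] at h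
      simp only [List.mem_cons, List.not_mem_nil, or_false]
      rcases h with h | h | h | h | h | h
      · exact Or.inl (e 2 (by norm_num) h)
      · exact Or.inr (Or.inl (e 3 (by norm_num) h))
      · exact Or.inr (Or.inr (Or.inl (e 5 (by norm_num) h)))
      · exact Or.inr (Or.inr (Or.inr (Or.inl (e 7 (by norm_num) h))))
      · exact Or.inr (Or.inr (Or.inr (Or.inr (Or.inl (e 11 (by norm_num) h)))))
      · exact Or.inr (Or.inr (Or.inr (Or.inr (Or.inr (e 13 (by norm_num) h)))))
    · right
      exact ⟨hp.2.one_lt.ne', (Nat.Prime.coprime_iff_not_dvd hp.2).mpr h⟩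
  have hge' : ∀ p ∈ mtbSet M, (2 : ℝ) ≤ p := fun p hp => by exact_mod_cast hge p hp
  have heq : ∀ p ∈ mtbSet M, (1 - 1 / (p : ℝ))⁻¹ = (p : ℝ) / ((p - 1 : ℕ) : ℝ) := by
    intro p hp
    have h2 := hge' p hp
    rw [Nat.cast_sub (by linarith [hge p hp])]
    have h3 : (p : ℝ) - 1 ≠ 0 := by linarith
    have h4 : (p : ℝ) ≠ 0 := by linarith
    push_cast
    field_simp
  have h1 : ∏ p ∈ N.primesBelow, (1 - 1 / (p : ℝ))⁻¹ ≤ ∏ p ∈ mtbSet M, (1 - 1 / (p : ℝ))⁻¹ := by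
    refine Finset.prod_le_prod_of_subset_of_one_le hsub ?_ ?_
    · intro p hp
      rw [heq p (hsub hp)]
      positivity
    · intro p hp _
      have h2 := hge' p hp
      have : 0 < 1 - 1 / (p : ℝ) := by
        rw [sub_pos, div_lt_one (by linarith)]; linarith
      rw [one_le_inv₀ this]
      linarith [show (0 : ℝ) ≤ 1 / p by positivity]
  refine h1.trans ?_
  rw [Finset.prod_congr rfl heq, Finset.prod_div_distrib, div_le_div_iff₀ ?_ (by exact_mod_cast hd)]
  · have h' : ((d * ∏ p ∈ mtbSet M, p : ℕ) : ℝ) ≤ ((c * ∏ p ∈ mtbSet M, (p - 1) : ℕ) : ℝ) :=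
      Nat.cast_le.mpr h
    rw [Nat.cast_mul, Nat.cast_mul, Nat.cast_prod, Nat.cast_prod] at h'
    rw [mul_comm]
    exact h'
  · refine Finset.prod_pos fun p hp => ?_
    have := hge p hp
    exact_mod_cast (by omega : 0 < p - 1)

lemma mtb_upper_small (x : ℝ) (hx : 2 ≤ x) (hx2 : x ≤ 256) :
    ∏ p ∈ (⌈x⌉₊).primesBelow, (1 - 1 / (p : ℝ))⁻¹ ≤ 6 * Real.log x := by
  have hl2 := Real.log_two_gt_d9
  rcases le_total x 7 with h7 | h7
  · have h := mtb_small ⌈x⌉₊ 7 4 1 (Nat.ceil_le.mpr (by exact_mod_cast h7)) one_pos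
      (by decide +kernel)
    have := Real.log_le_log (by norm_num) hx
    push_cast at h
    linarith
  rcases le_total x 16 with h16 | h16
  · have h := mtb_small ⌈x⌉₊ 16 6 1 (Nat.ceil_le.mpr (by exact_mod_cast h16)) one_pos
      (by decide +kernel)
    have := Real.log_le_log (by norm_num) (show (2 : ℝ) ^ 2 ≤ x by linarith)
    rw [Real.log_pow] at this
    push_cast at h this
    linarith
  · have h := mtb_small ⌈x⌉₊ 256 11 1 (Nat.ceil_le.mpr (by exact_mod_cast hx2)) one_pos
      (by decide +kernel)
    have := Real.log_le_log (by norm_num) (show (2 : ℝ) ^ 3 ≤ x by linarith)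
    rw [Real.log_pow] at this
    push_cast at h this
    linarith


/- **Mertens-type bound**: for every real `x ≥ 2`,
`log x ≤ ∏_{p prime, p < x} (1 − 1/p)⁻¹ ≤ 6 · log x`, the product ranging over all
prime numbers strictly less than `x`. -/
open Classical in
theorem mertens_type_bound (x : ℝ) (hx : 2 ≤ x) :
    Real.log x ≤
        (∏ p ∈ (Finset.range ⌈x⌉₊).filter fun p => Nat.Prime p ∧ (p : ℝ) < x,
          (1 - 1 / (p : ℝ))⁻¹) ∧
      (∏ p ∈ (Finset.range ⌈x⌉₊).filter fun p => Nat.Prime p ∧ (p : ℝ) < x,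
          (1 - 1 / (p : ℝ))⁻¹) ≤
        6 * Real.log x := by
  have hset : ((Finset.range ⌈x⌉₊).filter fun p => Nat.Prime p ∧ (p : ℝ) < x) =
      (⌈x⌉₊).primesBelow := by
    ext p
    rw [Finset.mem_filter, Finset.mem_range, Nat.mem_primesBelow, Nat.lt_ceil]
    tauto
  have hN2 : 2 ≤ ⌈x⌉₊ := by
    have : (2 : ℝ) ≤ ⌈x⌉₊ := hx.trans (Nat.le_ceil x)
    exact_mod_cast this
  rw [hset]
  refine ⟨?_, ?_⟩
  · refine (Real.log_le_log (by linarith) (Nat.le_ceil x)).trans ?_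
    exact mtb_lower _ (by omega)
  · rcases le_total x 256 with h | h
    · exact mtb_upper_small x hx h
    · refine mtb_upper_large x h _ (by omega) ?_ hN2
      exact (Nat.lt_ceil.mp (by omega)).le
end

section
/- Let Λ be a lattice (a discrete additive subgroup) of a finite-dimensional real inner product space V, let σ > 0, and let t, w ∈ V. Then g_σ(Λ + t + w) + g_σ(Λ + t − w) ≥ 2 · g_σ(w) · g_σ(Λ + t). -/
theorem gauss_summable_aux {V : Type*} [NormedAddCommGroup V] [InnerProductSpace ℝ V]
    [FiniteDimensional ℝ V] (Λ : AddSubgroup V) (hΛ : DiscreteTopology Λ)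
    (σ : ℝ) (hσ : 0 < σ) (t : V) :
    Summable fun ℓ : Λ => Real.exp (-Real.pi * ‖(ℓ : V) + t‖ ^ 2 / σ ^ 2) := by
  let L : Submodule ℤ V := AddSubgroup.toIntSubmodule Λ
  have : DiscreteTopology L := hΛ
  let k := Module.finrank ℤ L + 1
  have h1 : Summable fun z : L => ‖(z : V) - (-t)‖⁻¹ ^ (2 * k) :=
    ZLattice.summable_norm_sub_inv_pow L (2 * k) (by simp only [k]; omega) (-t)
  have h2 : Summable fun z : Λ => ‖(z : V) + t‖⁻¹ ^ (2 * k) := by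
    simp only [sub_neg_eq_add] at h1
    exact h1
  have hc : 0 < Real.pi / σ ^ 2 := by positivity
  refine Summable.of_norm_bounded_eventually
    (h2.mul_left ((k.factorial : ℝ) / (Real.pi / σ ^ 2) ^ k)) ?_
  have hfin : {z : Λ | (z : V) + t = 0}.Finite := by
    apply Set.Subsingleton.finite
    intro a ha b hb
    simp only [Set.mem_ofPred_eq] at ha hb
    exact Subtype.ext (add_right_cancel (ha.trans hb.symm))
  refine hfin.subset ?_
  intro z hz
  by_contra h
  apply hz
  have hr : 0 < ‖(z : V) + t‖ := norm_pos_iff.mpr h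
  change ‖Real.exp (-Real.pi * ‖(z : V) + t‖ ^ 2 / σ ^ 2)‖ ≤
    (k.factorial : ℝ) / (Real.pi / σ ^ 2) ^ k * ‖(z : V) + t‖⁻¹ ^ (2 * k)
  generalize ‖(z : V) + t‖ = r at hr ⊢
  have hy : 0 < Real.pi / σ ^ 2 * r ^ 2 := by positivity
  have h3 := Real.pow_div_factorial_le_exp _ hy.le k
  rw [Real.norm_eq_abs, Real.abs_exp,
    show -Real.pi * r ^ 2 / σ ^ 2 = -(Real.pi / σ ^ 2 * r ^ 2) by ring, Real.exp_neg]
  refine (inv_anti₀ (by positivity) h3).trans (le_of_eq ?_)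
  rw [inv_div, mul_pow, ← pow_mul, inv_pow]
  field_simp

/-- For a lattice (discrete additive subgroup) `Λ` of a finite-dimensional real inner product
space `V`, `σ > 0` and `t, w ∈ V`, the Gaussian masses `g_σ(S) = Σ_{x ∈ S} exp(−π‖x‖²/σ²)`
satisfy `g_σ(Λ + t + w) + g_σ(Λ + t − w) ≥ 2 · g_σ(w) · g_σ(Λ + t)`. -/
theorem gaussian_mass_shift_ineq {V : Type*} [NormedAddCommGroup V] [InnerProductSpace ℝ V]
    [FiniteDimensional ℝ V] (Λ : AddSubgroup V) (hΛ : DiscreteTopology Λ)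
    (σ : ℝ) (hσ : 0 < σ) (t w : V) :
    2 * Real.exp (-Real.pi * ‖w‖ ^ 2 / σ ^ 2) *
        ∑' ℓ : Λ, Real.exp (-Real.pi * ‖(ℓ : V) + t‖ ^ 2 / σ ^ 2) ≤
      (∑' ℓ : Λ, Real.exp (-Real.pi * ‖(ℓ : V) + t + w‖ ^ 2 / σ ^ 2)) +
        ∑' ℓ : Λ, Real.exp (-Real.pi * ‖(ℓ : V) + t - w‖ ^ 2 / σ ^ 2) := by
  have hp := gauss_summable_aux Λ hΛ σ hσ (t + w)
  have hm := gauss_summable_aux Λ hΛ σ hσ (t - w)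
  have h0 := gauss_summable_aux Λ hΛ σ hσ t
  simp only [← add_assoc] at hp
  simp only [← add_sub_assoc] at hm
  rw [← hp.tsum_add hm, ← tsum_mul_left]
  refine (h0.mul_left _).tsum_le_tsum (fun ℓ => ?_) (hp.add hm)
  generalize (ℓ : V) + t = x
  set a := Real.pi / σ ^ 2
  rw [norm_add_sq_real, norm_sub_sq_real]
  set i := inner ℝ x w
  have e1 : -Real.pi * (‖x‖ ^ 2 + 2 * i + ‖w‖ ^ 2) / σ ^ 2
      = -Real.pi * ‖w‖ ^ 2 / σ ^ 2 + -Real.pi * ‖x‖ ^ 2 / σ ^ 2 + -(2 * a * i) := by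
    simp only [a]; ring
  have e2 : -Real.pi * (‖x‖ ^ 2 - 2 * i + ‖w‖ ^ 2) / σ ^ 2
      = -Real.pi * ‖w‖ ^ 2 / σ ^ 2 + -Real.pi * ‖x‖ ^ 2 / σ ^ 2 + 2 * a * i := by
    simp only [a]; ring
  rw [e1, e2, Real.exp_add _ (-(2 * a * i)), Real.exp_add _ (2 * a * i), mul_assoc,
    ← Real.exp_add, ← mul_add]
  have hcosh := Real.one_le_cosh (2 * a * i)
  rw [Real.cosh_eq] at hcosh
  rw [mul_comm]
  exact mul_le_mul_of_nonneg_left (by linarith) (Real.exp_pos _).le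
end

section
/- Let Λ be a lattice (a discrete additive subgroup) of a finite-dimensional real inner product space V, let t ∈ V, let c > 0 and σ > 0, and assume that Λ is generated as an additive group by its elements of Euclidean norm at most σ/c. Then for every strict additive subgroup Λ' ⊊ Λ one has g_σ(Λ' + t) / g_σ(Λ + t) ≤ 1/(1 + exp(−π·c⁻²)). -/
theorem gaussian_pointwise_aux {V : Type*} [NormedAddCommGroup V]
    [InnerProductSpace ℝ V] (c σ : ℝ) (hc : 0 < c) (hσ : 0 < σ) (x y : V) (hy : ‖y‖ ≤ σ / c) :
    2 * (Real.exp (-Real.pi * c⁻¹ ^ 2) * Real.exp (-Real.pi * ‖x‖ ^ 2 / σ ^ 2)) ≤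
      Real.exp (-Real.pi * ‖x + y‖ ^ 2 / σ ^ 2) + Real.exp (-Real.pi * ‖x - y‖ ^ 2 / σ ^ 2) := by
  have hpar := parallelogram_law_with_norm ℝ x y
  have amgm : ∀ a b : ℝ, 2 * Real.exp ((a + b) / 2) ≤ Real.exp a + Real.exp b := by
    intro a b
    have h1 : Real.exp a = Real.exp (a / 2) ^ 2 := by
      rw [← Real.exp_nat_mul]; congr 1; push_cast; ring
    have h2 : Real.exp b = Real.exp (b / 2) ^ 2 := by
      rw [← Real.exp_nat_mul]; congr 1; push_cast; ring
    rw [add_div, Real.exp_add, h1, h2]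
    nlinarith [sq_nonneg (Real.exp (a / 2) - Real.exp (b / 2))]
  refine le_trans ?_ (amgm _ _)
  rw [← Real.exp_add]
  have hy2 : ‖y‖ ^ 2 / σ ^ 2 ≤ c⁻¹ ^ 2 := by
    rw [← div_pow]
    refine pow_le_pow_left₀ (by positivity) ?_ 2
    rw [div_le_iff₀ hσ, mul_comm, ← div_eq_mul_inv]
    exact hy
  have key : (-Real.pi * ‖x + y‖ ^ 2 / σ ^ 2 + -Real.pi * ‖x - y‖ ^ 2 / σ ^ 2) / 2
      = -Real.pi * (‖y‖ ^ 2 / σ ^ 2) + -Real.pi * ‖x‖ ^ 2 / σ ^ 2 := by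
    have : ‖x + y‖ ^ 2 + ‖x - y‖ ^ 2 = 2 * (‖x‖ ^ 2 + ‖y‖ ^ 2) := by
      exact hpar
    have h3 : ‖x + y‖ ^ 2 = 2 * (‖x‖ ^ 2 + ‖y‖ ^ 2) - ‖x - y‖ ^ 2 := by linarith
    rw [h3]; ring
  rw [key]
  have := mul_le_mul_of_nonneg_left hy2 Real.pi_pos.le
  refine mul_le_mul_of_nonneg_left (Real.exp_le_exp.2 ?_) (by norm_num)
  linarith

theorem coset_sum_aux {V : Type*} [AddCommGroup V] (Λ Λ' : AddSubgroup V) (hle : Λ' ≤ Λ)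
    (f : V → ℝ) (hf : ∀ x, 0 ≤ f x) (hs : Summable fun ℓ : Λ => f ℓ)
    (z : V) (hz : z ∈ Λ) (hz' : z ∉ Λ') :
    Summable (fun ℓ : Λ' => f ℓ) ∧ Summable (fun ℓ : Λ' => f (ℓ + z)) ∧
      ∑' ℓ : Λ', f ℓ + ∑' ℓ : Λ', f (ℓ + z) ≤ ∑' ℓ : Λ, f ℓ := by
  obtain ⟨i, hi1, hi2⟩ : ∃ i : Λ' ⊕ Λ' → Λ, (∀ ℓ, (i (Sum.inl ℓ) : V) = ℓ) ∧
      (∀ ℓ, (i (Sum.inr ℓ) : V) = ℓ + z) :=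
    ⟨Sum.elim (fun ℓ => ⟨ℓ, hle ℓ.2⟩) (fun ℓ => ⟨ℓ + z, Λ.add_mem (hle ℓ.2) hz⟩),
      fun _ => rfl, fun _ => rfl⟩
  have hi : Function.Injective i := by
    rintro (a | a) (b | b) h
    · have h : (a : V) = b := by simpa only [hi1, hi2] using congrArg Subtype.val h
      exact congrArg _ (Subtype.ext h)
    · exfalso
      have h : (a : V) = b + z := by simpa only [hi1, hi2] using congrArg Subtype.val h
      exact hz' (by rw [show z = (a : V) - b by rw [h]; abel]; exact Λ'.sub_mem a.2 b.2)
    · exfalso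
      have h : (a : V) + z = b := by simpa only [hi1, hi2] using congrArg Subtype.val h
      exact hz' (by rw [show z = (b : V) - a by rw [← h]; abel]; exact Λ'.sub_mem b.2 a.2)
    · have h : (a : V) + z = b + z := by simpa only [hi1, hi2] using congrArg Subtype.val h
      exact congrArg _ (Subtype.ext (add_right_cancel h))
  have hsi := hs.comp_injective hi
  have h1 : Summable (fun ℓ : Λ' => f ℓ) := by
    simpa only [Function.comp_def, hi1] using hsi.comp_injective Sum.inl_injective
  have h2 : Summable (fun ℓ : Λ' => f (ℓ + z)) := by
    simpa only [Function.comp_def, hi2] using hsi.comp_injective Sum.inr_injective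
  refine ⟨h1, h2, ?_⟩
  have h3 : ∑' s, ((fun ℓ : Λ => f ℓ) ∘ i) s = ∑' ℓ : Λ', f ℓ + ∑' ℓ : Λ', f (ℓ + z) :=
    (HasSum.sum (f := (fun ℓ : Λ => f ℓ) ∘ i)
      (by simpa only [Function.comp_def, hi1] using h1.hasSum)
      (by simpa only [Function.comp_def, hi2] using h2.hasSum)).tsum_eq
  rw [← h3]
  exact hsi.tsum_le_tsum_of_inj i hi (fun c _ => hf c) (fun _ => le_rfl) hs

/-- Let `Λ` be a lattice (discrete additive subgroup) of a finite-dimensional real inner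
product space `V`, generated as an additive group by its elements of norm at most `σ/c`
(with `c, σ > 0`), and let `t ∈ V`.  Then for every strict additive subgroup `Λ' ⊊ Λ`,
`g_σ(Λ' + t) / g_σ(Λ + t) ≤ 1/(1 + exp(−π·c⁻²))`, where
`g_σ(S) = Σ_{x ∈ S} exp(−π‖x‖²/σ²)`. -/
theorem gaussian_mass_strict_subgroup {V : Type*} [NormedAddCommGroup V]
    [InnerProductSpace ℝ V] [FiniteDimensional ℝ V]
    (Λ Λ' : AddSubgroup V) (hΛ : DiscreteTopology Λ)
    (c σ : ℝ) (hc : 0 < c) (hσ : 0 < σ)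
    (hgen : AddSubgroup.closure {x : V | x ∈ Λ ∧ ‖x‖ ≤ σ / c} = Λ)
    (hlt : Λ' < Λ) (t : V) :
    (∑' ℓ : Λ', Real.exp (-Real.pi * ‖(ℓ : V) + t‖ ^ 2 / σ ^ 2)) /
        (∑' ℓ : Λ, Real.exp (-Real.pi * ‖(ℓ : V) + t‖ ^ 2 / σ ^ 2)) ≤
      1 / (1 + Real.exp (-Real.pi * c⁻¹ ^ 2)) := by
  obtain ⟨y, ⟨hyΛ, hyn⟩, hy'⟩ : ∃ y ∈ {x : V | x ∈ Λ ∧ ‖x‖ ≤ σ / c}, y ∉ Λ' := by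
    by_contra! h
    exact absurd (hgen ▸ (AddSubgroup.closure_le Λ').2 h) (not_le_of_gt hlt)
  by_cases hs : Summable fun ℓ : Λ => Real.exp (-Real.pi * ‖(ℓ : V) + t‖ ^ 2 / σ ^ 2)
  swap
  · rw [tsum_eq_zero_of_not_summable hs, div_zero]
    positivity
  obtain ⟨s0, s1, hp⟩ := coset_sum_aux Λ Λ' hlt.le
    (fun x => Real.exp (-Real.pi * ‖x + t‖ ^ 2 / σ ^ 2)) (fun _ => (Real.exp_pos _).le) hs
    y hyΛ hy'
  obtain ⟨-, s2, hm⟩ := coset_sum_aux Λ Λ' hlt.le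
    (fun x => Real.exp (-Real.pi * ‖x + t‖ ^ 2 / σ ^ 2)) (fun _ => (Real.exp_pos _).le) hs
    (-y) (Λ.neg_mem hyΛ) (fun h => hy' (by simpa using Λ'.neg_mem h))
  have hpos : 0 < ∑' ℓ : Λ, Real.exp (-Real.pi * ‖(ℓ : V) + t‖ ^ 2 / σ ^ 2) :=
    hs.tsum_pos (fun _ => (Real.exp_pos _).le) 0 (Real.exp_pos _)
  have hsum := Summable.tsum_le_tsum (fun ℓ : Λ' => by
    have h := gaussian_pointwise_aux c σ hc hσ ((ℓ : V) + t) y hyn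
    rw [show (ℓ : V) + t + y = ℓ + y + t by abel, show (ℓ : V) + t - y = ℓ + -y + t by abel] at h
    exact h) ((s0.mul_left _).mul_left 2) (s1.add s2)
  rw [tsum_mul_left, tsum_mul_left, s1.tsum_add s2] at hsum
  rw [div_le_div_iff₀ hpos (by positivity)]
  linarith
end

section
/- Let X be a countable set, let ⊥ be a symbol not in X, and let A, A' : X ∪ {⊥} → [0, ∞) be two probability distributions (nonnegative, with total sum 1). Set p₀ = Σ_{x∈X} A(x) and p₁ = Σ_{x∈X} A'(x), and suppose p₀ ≥ p and p₁ ≥ p for some p ∈ (0, 1]. Then the conditional distributions B(x) = A(x)/p₀ and B'(x) = A'(x)/p₁ on X satisfy ½ Σ_{x∈X} |B(x) − B'(x)| ≤ (½ Σ_{y∈X∪{⊥}} |A(y) − A'(y)|) / p. -/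
/-- Splitting a sum over `Option X`. -/
theorem hasSum_option_aux {X : Type*} (f : Option X → ℝ) (hf : Summable f) :
    Summable (fun x : X => f (some x)) ∧ ∑' y, f y = f none + ∑' x : X, f (some x) := by
  have hs : Summable (fun x : X => f (some x)) := hf.comp_injective (Option.some_injective X)
  refine ⟨hs, ?_⟩
  have e := (Equiv.optionEquivSumPUnit X).symm.tsum_eq f
  rw [← e]
  have h2 := Summable.tsum_sum (f := fun c => f ((Equiv.optionEquivSumPUnit.{0} X).symm c))
    (by simpa [Function.comp_def] using hs) (by exact (hasSum_fintype _).summable)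
  rw [h2]
  simp [add_comm]

/-- **Total variation distance of conditioned distributions.**
Let `A, A' : X ∪ {⊥} → [0,∞)` be probability distributions on a countable set `X` together
with a failure symbol `⊥`, with success probabilities `p₀ = Σ_{x∈X} A(x)` and
`p₁ = Σ_{x∈X} A'(x)` both at least `p ∈ (0,1]`.  Then the distributions obtained by
conditioning on success satisfy
`½ Σ_{x∈X} |A(x)/p₀ − A'(x)/p₁| ≤ (½ Σ_{y∈X∪{⊥}} |A(y) − A'(y)|) / p`. -/
theorem tv_dist_conditioned_le {X : Type*} [Countable X] (A A' : Option X → ℝ)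
    (hA : ∀ y, 0 ≤ A y) (hA' : ∀ y, 0 ≤ A' y)
    (hA1 : HasSum A 1) (hA'1 : HasSum A' 1)
    (p : ℝ) (hp0 : 0 < p) (hp1 : p ≤ 1)
    (hpA : p ≤ ∑' x : X, A (some x)) (hpA' : p ≤ ∑' x : X, A' (some x)) :
    1 / 2 * ∑' x : X, |A (some x) / (∑' x' : X, A (some x')) -
        A' (some x) / (∑' x' : X, A' (some x'))| ≤
      (1 / 2 * ∑' y : Option X, |A y - A' y|) / p := by
  obtain ⟨sA, eA⟩ := hasSum_option_aux A hA1.summable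
  obtain ⟨sA', eA'⟩ := hasSum_option_aux A' hA'1.summable
  obtain ⟨sD, eD⟩ := hasSum_option_aux (fun y => |A y - A' y|) (hA1.summable.sub hA'1.summable).abs
  rw [hA1.tsum_eq] at eA
  rw [hA'1.tsum_eq] at eA'
  rw [eD]
  generalize hP : ∑' x : X, A (some x) = P at *
  generalize hQ : ∑' x : X, A' (some x) = Q at *
  have hP0 : 0 < P := by linarith
  have hQ0 : 0 < Q := by linarith
  have key : ∀ x : X, |A (some x) / P - A' (some x) / Q| ≤
      |A (some x) - A' (some x)| * P⁻¹ + A' (some x) * |P⁻¹ - Q⁻¹| := by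
    intro x
    have h : A (some x) / P - A' (some x) / Q =
        (A (some x) - A' (some x)) * P⁻¹ + A' (some x) * (P⁻¹ - Q⁻¹) := by
      rw [div_eq_mul_inv, div_eq_mul_inv]; ring
    rw [h]
    refine (abs_add_le _ _).trans (le_of_eq ?_)
    rw [abs_mul, abs_mul, abs_of_pos (inv_pos.2 hP0), abs_of_nonneg (hA' (some x))]
  have s1 := sD.mul_right P⁻¹
  have s2 := sA'.mul_right |P⁻¹ - Q⁻¹|
  have sL : Summable (fun x : X => |A (some x) / P - A' (some x) / Q|) :=
    ((sA.div_const P).sub (sA'.div_const Q)).abs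
  have hle := sL.tsum_le_tsum key (s1.add s2)
  rw [s1.tsum_add s2, tsum_mul_right, tsum_mul_right, hQ] at hle
  have hn : |A none - A' none| = |P - Q| := by
    rw [abs_sub_comm P Q]; congr 1; linarith
  have hq : Q * |P⁻¹ - Q⁻¹| = |P - Q| * P⁻¹ := by
    rw [abs_sub_comm P Q, ← abs_of_pos hQ0, ← abs_mul, abs_of_pos hQ0,
      ← abs_of_pos (inv_pos.2 hP0), ← abs_mul, abs_of_pos (inv_pos.2 hP0)]
    congr 1
    field_simp
  rw [hq] at hle
  have hS : 0 ≤ ∑' x : X, |A (some x) - A' (some x)| := tsum_nonneg fun _ => abs_nonneg _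
  simp only [hn]
  have hinv : P⁻¹ ≤ p⁻¹ := by gcongr
  have := mul_le_mul_of_nonneg_left hinv (add_nonneg (abs_nonneg (P - Q)) hS)
  rw [div_eq_mul_inv _ p]
  linarith
end

section
/- Let K be a number field of degree n with discriminant Δ_K. Then there exists an algebraic integer β ∈ O_K such that K = ℚ(β) and every coefficient g_i of the (monic, irreducible) minimal polynomial g = Σ_{i=0}^n g_i X^i ∈ ℤ[X] of β satisfies |g_i| ≤ e · n^{3n} · |Δ_K|. -/
open NumberField NumberField.InfinitePlace NumberField.mixedEmbedding Module in
lemma minkowskiBound_one_eq (K : Type*) [Field K] [NumberField K] :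
    minkowskiBound K 1 =
      (((2 : NNReal) ^ (nrRealPlaces K + nrComplexPlaces K) *
        NNReal.sqrt ‖discr K‖₊ : NNReal) : ENNReal) := by
  classical
  rw [minkowskiBound, volume_fundamentalDomain_fractionalIdealLatticeBasis,
    Units.val_one, FractionalIdeal.absNorm_one, Rat.cast_one,
    ENNReal.ofReal_one, one_mul, mixedEmbedding.finrank, volume_fundamentalDomain_latticeBasis,
    ← card_add_two_mul_card_eq_rank]
  have h : (2 : ENNReal)⁻¹ ^ nrComplexPlaces K * 2 ^ nrComplexPlaces K = 1 := by
    rw [← mul_pow, ENNReal.inv_mul_cancel (by simp) (by simp), one_pow]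
  rw [two_mul, ← add_assoc, pow_add _ _ (nrComplexPlaces K)]
  push_cast
  rw [mul_comm, mul_assoc, ← mul_assoc (2 ^ nrComplexPlaces K), mul_comm (2 ^ nrComplexPlaces K),
    h, one_mul]

open NumberField NumberField.InfinitePlace Polynomial in
lemma coeff_minpoly_le (K : Type*) [Field K] [NumberField K] (β : 𝓞 K)
    (hβ : IntermediateField.adjoin ℚ {(β : K)} = ⊤) (i : ℕ) :
    |((minpoly ℤ (β : K)).coeff i : ℝ)| ≤
      2 ^ (Module.finrank ℚ K) * ∏ w : InfinitePlace K, (max 1 (w (β : K))) ^ mult w := by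
  classical
  have hint := β.isIntegral_coe
  have hQ := minpoly.isIntegrallyClosed_eq_field_fractions' ℚ hint
  set p : ℂ[X] := (minpoly ℚ (β : K)).map (algebraMap ℚ ℂ) with hp
  have hmon : (minpoly ℚ (β : K)).Monic := minpoly.monic (Algebra.IsIntegral.isIntegral _)
  have hsep : (minpoly ℚ (β : K)).Separable := Algebra.IsSeparable.isSeparable ℚ (β : K)
  have hdeg : p.natDegree = Module.finrank ℚ K := by
    rw [hp, hmon.natDegree_map]
    exact (Field.primitive_element_iff_minpoly_natDegree_eq ℚ (β : K)).mp hβ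
  have hc : ‖p.coeff i‖ = |((minpoly ℤ (β : K)).coeff i : ℝ)| := by
    rw [hp, coeff_map, hQ, coeff_map]
    simp
  have hinj : Function.Injective fun φ : K →+* ℂ ↦ φ (β : K) := by
    have := (Field.primitive_element_iff_algHom_eq_of_eval' ℚ ℂ
      (fun _ ↦ IsAlgClosed.splits _) (β : K)).mp hβ
    intro φ ψ h
    have h2 : φ.toRatAlgHom = ψ.toRatAlgHom := this h
    ext x
    exact DFunLike.congr_fun h2 x
  have hroots : p.roots = (Finset.univ.image fun φ : K →+* ℂ ↦ φ (β : K)).val := by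
    have hnd : p.roots.Nodup := nodup_roots hsep.map
    have : p.roots.toFinset = Finset.univ.image fun φ : K →+* ℂ ↦ φ (β : K) := by
      have h := Embeddings.range_eval_eq_rootSet_minpoly K ℂ (β : K)
      apply Finset.coe_injective
      rw [Finset.coe_image, Finset.coe_univ, Set.image_univ, h]
      rfl
    rw [← this, Multiset.toFinset_val, hnd.dedup]
  have hM : p.mahlerMeasure = ∏ w : InfinitePlace K, (max 1 (w (β : K))) ^ mult w := by
    rw [mahlerMeasure_eq_leadingCoeff_mul_prod_roots, (hmon.map _).leadingCoeff, norm_one, one_mul,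
      hroots]
    change ∏ z ∈ Finset.univ.image (fun φ : K →+* ℂ ↦ φ (β : K)), max 1 ‖z‖ = _
    rw [Finset.prod_image (fun _ _ _ _ h ↦ hinj h),
      ← Finset.prod_fiberwise Finset.univ InfinitePlace.mk (fun φ : K →+* ℂ => max 1 ‖φ (β : K)‖)]
    have (w : InfinitePlace K) (φ) (hφ : φ ∈ ({φ | InfinitePlace.mk φ = w} : Finset _)) :
        max 1 ‖φ (β : K)‖ = max 1 (w (β : K)) := by
      rw [← (Finset.mem_filter.mp hφ).2, InfinitePlace.apply]
    simp_rw [Finset.prod_congr rfl (this _), Finset.prod_const, card_filter_mk_eq]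
  rw [← hc, ← hM, ← hdeg]
  refine (norm_coeff_le_choose_mul_mahlerMeasure i p).trans ?_
  gcongr
  · exact mahlerMeasure_nonneg p
  · exact_mod_cast Nat.choose_le_two_pow _ _

open NumberField NumberField.InfinitePlace in
lemma prod_le_of_lt_one (K : Type*) [Field K] [NumberField K] (a : K) (w₀ : InfinitePlace K)
    (h : ∀ w, w ≠ w₀ → w a < 1) :
    ∏ w : InfinitePlace K, (max 1 (w a)) ^ mult w = (max 1 (w₀ a)) ^ mult w₀ := by
  apply Fintype.prod_eq_single
  intro w hw
  rw [max_eq_left (h w hw).le, one_pow]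

open NumberField NumberField.InfinitePlace NumberField.mixedEmbedding in
lemma exists_primitive_prod_le (K : Type*) [Field K] [NumberField K] :
    ∃ β : 𝓞 K, IntermediateField.adjoin ℚ {(β : K)} = ⊤ ∧
      ∏ w : InfinitePlace K, (max 1 (w (β : K))) ^ mult w ≤ 5 * |(discr K : ℝ)| := by
  classical
  obtain ⟨w₀⟩ : Nonempty (InfinitePlace K) := inferInstance
  have hD : (1 : ℝ) ≤ |(discr K : ℝ)| := by
    exact_mod_cast Int.one_le_abs (discr_ne_zero K)
  set s : NNReal := NNReal.sqrt ‖discr K‖₊ with hs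
  have hs2 : (s : ℝ) ^ 2 = |(discr K : ℝ)| := by
    rw [← NNReal.coe_pow, hs, NNReal.sq_sqrt, coe_nnnorm, Int.norm_eq_abs]
  have hs1 : (1 : ℝ) ≤ s := by
    by_contra! hlt
    have := s.coe_nonneg
    nlinarith
  have hs0 : 0 < s := by
    have : (0 : ℝ) < s := by linarith
    exact_mod_cast this
  have hpi : (2 : NNReal) ≤ NNReal.pi := Real.two_le_pi
  have hss : s < 2 * s := by
    have : (s : ℝ) < 2 * s := by linarith
    exact_mod_cast this
  rcases isReal_or_isComplex w₀ with hw₀ | hw₀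
  · have : minkowskiBound K ↑1 <
        MeasureTheory.volume (convexBodyLT K (fun w ↦ if w = w₀ then 2 * s else 1)) := by
      rw [convexBodyLT_volume, ← Finset.prod_erase_mul _ _ (Finset.mem_univ w₀)]
      simp_rw [ite_pow, one_pow]
      rw [Finset.prod_ite_eq']
      simp_rw [Finset.notMem_erase, ite_false, mult, hw₀, ite_true, one_mul, pow_one]
      rw [minkowskiBound_one_eq K, ← ENNReal.coe_mul, ENNReal.coe_lt_coe,
        ← hs, pow_add]
      calc _ < (2 : NNReal) ^ nrRealPlaces K * 2 ^ nrComplexPlaces K * (2 * s) := by gcongr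
        _ ≤ _ := by unfold convexBodyLTFactor; gcongr
    obtain ⟨a, h_nz, h_le⟩ := exists_ne_zero_mem_ringOfIntegers_lt K this
    have h1 : ∀ w, w ≠ w₀ → w (a : K) < 1 := fun w h_ne ↦ by
      simpa [h_ne] using h_le w
    refine ⟨a, is_primitive_element_of_infinitePlace_lt h_nz (fun w h ↦ h1 w h) (Or.inl hw₀), ?_⟩
    rw [prod_le_of_lt_one K _ w₀ h1, mult, if_pos hw₀, pow_one]
    have h2 : w₀ (a : K) < 2 * s := by simpa using h_le w₀
    apply max_le <;> nlinarith
  · have : minkowskiBound K ↑1 < MeasureTheory.volume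
        (convexBodyLT' K (fun w ↦ if w = w₀ then NNReal.sqrt (2 * s) else 1) ⟨w₀, hw₀⟩) := by
      rw [convexBodyLT'_volume, ← Finset.prod_erase_mul _ _ (Finset.mem_univ w₀)]
      simp_rw [ite_pow, one_pow]
      rw [Finset.prod_ite_eq']
      simp_rw [Finset.notMem_erase, ite_false, mult, not_isReal_iff_isComplex.mpr hw₀,
        ite_true, ite_false, one_mul, NNReal.sq_sqrt]
      rw [minkowskiBound_one_eq K, ← ENNReal.coe_mul, ENNReal.coe_lt_coe,
        ← hs]
      have hr : nrRealPlaces K + nrComplexPlaces K ≤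
          (nrRealPlaces K + 2) + (nrComplexPlaces K - 1) := by omega
      calc _ < (2 : NNReal) ^ (nrRealPlaces K + nrComplexPlaces K) * (2 * s) := by gcongr
        _ ≤ (2 : NNReal) ^ ((nrRealPlaces K + 2) + (nrComplexPlaces K - 1)) * (2 * s) := by
          gcongr; exact one_le_two
        _ ≤ _ := by rw [pow_add]; unfold convexBodyLT'Factor; gcongr
    obtain ⟨a, h_nz, h_le, h_le₀⟩ := exists_ne_zero_mem_ringOfIntegers_lt' K ⟨w₀, hw₀⟩ this
    have h1 : ∀ w, w ≠ w₀ → w (a : K) < 1 := fun w h_ne ↦ by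
      simpa [h_ne] using h_le w h_ne
    refine ⟨a, is_primitive_element_of_infinitePlace_lt h_nz (fun w h ↦ h1 w h)
      (Or.inr h_le₀.1), ?_⟩
    rw [prod_le_of_lt_one K _ w₀ h1, mult, if_neg (not_isReal_iff_isComplex.mpr hw₀)]
    have h2 : |(w₀.embedding (a : K)).im| < 2 * s := by
      have := h_le₀.2
      simp only [if_true] at this
      rwa [← NNReal.coe_pow, NNReal.sq_sqrt] at this
    have h3 : |(w₀.embedding (a : K)).re| < 1 := h_le₀.1
    have h4 : w₀ (a : K) ^ 2 ≤ 1 + (2 * s) ^ 2 := by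
      rw [← norm_embedding_eq, Complex.sq_norm, Complex.normSq_apply, ← pow_two, ← pow_two,
        ← sq_abs (w₀.embedding (a : K)).re, ← sq_abs (w₀.embedding (a : K)).im]
      have := abs_nonneg (w₀.embedding (a : K)).re
      have := abs_nonneg (w₀.embedding (a : K)).im
      nlinarith
    rcases max_choice 1 (w₀ (a : K)) with h | h <;> rw [h] <;> nlinarith

/-- **Every number field has a small defining polynomial.**
For a number field `K` of degree `n` with discriminant `Δ_K`, there exists an algebraic
integer `β` with `K = ℚ(β)` such that every coefficient `g_i` of the minimal polynomial
`g ∈ ℤ[X]` of `β` satisfies `|g_i| ≤ e · n^{3n} · |Δ_K|`. -/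
theorem exists_primitive_int_small_minpoly (K : Type*) [Field K] [NumberField K] :
    ∃ β : NumberField.RingOfIntegers K,
      IntermediateField.adjoin ℚ {(β : K)} = ⊤ ∧
        ∀ i : ℕ,
          |((minpoly ℤ (β : K)).coeff i : ℝ)| ≤
            Real.exp 1 * (Module.finrank ℚ K : ℝ) ^ (3 * Module.finrank ℚ K) *
              |(NumberField.discr K : ℝ)| := by
  have hD : (1 : ℝ) ≤ |(NumberField.discr K : ℝ)| := by
    exact_mod_cast Int.one_le_abs (NumberField.discr_ne_zero K)
  have he : (1 : ℝ) ≤ Real.exp 1 := Real.one_le_exp zero_le_one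
  have hn0 : 0 < Module.finrank ℚ K := Module.finrank_pos
  rcases Nat.lt_or_ge 1 (Module.finrank ℚ K) with hn | hn
  · obtain ⟨β, hβ, hprod⟩ := exists_primitive_prod_le K
    refine ⟨β, hβ, fun i ↦ (coeff_minpoly_le K β hβ i).trans ?_⟩
    set n := Module.finrank ℚ K
    have h4 : (5 : ℝ) ≤ 4 ^ n := by
      calc (5 : ℝ) ≤ 4 ^ 2 := by norm_num
        _ ≤ 4 ^ n := pow_le_pow_right₀ (by norm_num) hn
    have h2 : (2 : ℝ) ≤ n := by exact_mod_cast hn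
    calc (2 : ℝ) ^ n * _ ≤ 2 ^ n * (5 * |(NumberField.discr K : ℝ)|) := by gcongr
      _ ≤ 2 ^ n * (4 ^ n * |(NumberField.discr K : ℝ)|) := by gcongr
      _ = 1 * 2 ^ (3 * n) * |(NumberField.discr K : ℝ)| := by
        rw [← mul_assoc, ← mul_pow, pow_mul]; norm_num
      _ ≤ _ := by gcongr
  · have h1 : Module.finrank ℚ K = 1 := by omega
    refine ⟨0, ?_, fun i ↦ ?_⟩
    · have := IntermediateField.bot_eq_top_of_finrank_adjoin_eq_one (F := ℚ) (E := K) (fun x ↦ by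
        apply le_antisymm _ Module.finrank_pos
        rw [← h1]
        exact IntermediateField.finrank_le_of_le_right le_top |>.trans (by simp))
      simpa using this
    · have : |((minpoly ℤ ((0 : NumberField.RingOfIntegers K) : K)).coeff i : ℝ)| ≤ 1 := by
        have hX : minpoly ℤ (0 : K) = Polynomial.X := by
          apply Polynomial.map_injective (algebraMap ℤ ℚ) Int.cast_injective
          rw [← minpoly.isIntegrallyClosed_eq_field_fractions' ℚ isIntegral_zero, minpoly.zero,
            Polynomial.map_X]
        rw [show ((0 : NumberField.RingOfIntegers K) : K) = 0 from rfl, hX, Polynomial.coeff_X]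
        split_ifs <;> simp
      rw [h1]
      norm_num
      norm_num at this
      nlinarith
end

section
/- Let E be a field extension of ℚ and let α, β ∈ E be algebraic over ℚ, with d_α = [ℚ(α):ℚ] and d_β = [ℚ(β):ℚ]. Then there exists a natural number λ with 0 ≤ λ ≤ d_α · d_β such that ℚ(α + λ·β) = ℚ(α, β). -/
open Polynomial IntermediateField in
/-- If `c` avoids the finitely many bad values, then `α + c • β` is primitive. -/
theorem primitive_aux {F : Type*} [Field F] [CharZero F] {E : Type*} [Field E] [Algebra F E]
    (α β : E) (hα : IsIntegral F α) (hβ : IsIntegral F β) (c : F)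
    (hc : ∀ α' ∈ ((minpoly F α).map ((algebraMap E (SplittingField ((minpoly F β).map
        (algebraMap F E)))).comp (algebraMap F E))).roots,
      ∀ β' ∈ ((minpoly F β).map ((algebraMap E (SplittingField ((minpoly F β).map
        (algebraMap F E)))).comp (algebraMap F E))).roots,
      -(α' - algebraMap E _ α) / (β' - algebraMap E _ β) ≠
        ((algebraMap E (SplittingField ((minpoly F β).map
        (algebraMap F E)))).comp (algebraMap F E)) c) :
    F⟮α, β⟯ = F⟮α + c • β⟯ := by
  let f := minpoly F α
  let g := minpoly F β
  let ιFE := algebraMap F E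
  let ιEE' := algebraMap E (SplittingField (g.map ιFE))
  let γ := α + c • β
  suffices β_in_Fγ : β ∈ F⟮γ⟯ by
    apply le_antisymm
    · rw [adjoin_le_iff]
      have α_in_Fγ : α ∈ F⟮γ⟯ := by
        rw [← add_sub_cancel_right α (c • β)]
        exact F⟮γ⟯.sub_mem (mem_adjoin_simple_self F γ) (F⟮γ⟯.toSubalgebra.smul_mem β_in_Fγ c)
      rintro x (rfl | rfl) <;> assumption
    · rw [adjoin_simple_le_iff]
      have α_in_Fαβ : α ∈ F⟮α, β⟯ := subset_adjoin F {α, β} (Set.mem_insert α {β})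
      have β_in_Fαβ : β ∈ F⟮α, β⟯ := subset_adjoin F {α, β} (Set.mem_insert_of_mem α rfl)
      exact F⟮α, β⟯.add_mem α_in_Fαβ (F⟮α, β⟯.smul_mem β_in_Fαβ)
  classical
  let p := EuclideanDomain.gcd ((f.map (algebraMap F F⟮γ⟯)).comp
    (C (AdjoinSimple.gen F γ) - (C ↑c : F⟮γ⟯[X]) * X)) (g.map (algebraMap F F⟮γ⟯))
  let h := EuclideanDomain.gcd ((f.map ιFE).comp (C γ - C (ιFE c) * X)) (g.map ιFE)
  have map_g_ne_zero : g.map ιFE ≠ 0 := map_ne_zero (minpoly.ne_zero hβ)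
  have h_ne_zero : h ≠ 0 :=
    mt EuclideanDomain.gcd_eq_zero_iff.mp (not_and.mpr fun _ => map_g_ne_zero)
  suffices p_linear : p.map (algebraMap F⟮γ⟯ E) = C h.leadingCoeff * (X - C β) by
    have finale : β = algebraMap F⟮γ⟯ E (-p.coeff 0 / p.coeff 1) := by
      simp [map_div₀, map_neg, ← coeff_map, ← coeff_map, p_linear,
        mul_sub, coeff_C, mul_div_cancel_left₀ β (mt leadingCoeff_eq_zero.mp h_ne_zero)]
    rw [finale]
    exact Subtype.mem (-p.coeff 0 / p.coeff 1)
  have h_sep : h.Separable := separable_gcd_right _ (.map ((minpoly.irreducible hβ).separable))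
  have h_root : h.eval β = 0 := by
    apply eval_gcd_eq_zero
    · rw [eval_comp, eval_sub, eval_mul, eval_C, eval_C, eval_X, eval_map_algebraMap, ←
        Algebra.smul_def, add_sub_cancel_right, minpoly.aeval]
    · rw [eval_map_algebraMap, minpoly.aeval]
  have h_splits : Splits (h.map ιEE') := by
    rw [← Polynomial.gcd_map]
    exact (SplittingField.splits _).of_dvd (map_ne_zero map_g_ne_zero)
      (EuclideanDomain.gcd_dvd_right _ _)
  have h_roots : ∀ x ∈ (h.map ιEE').roots, x = ιEE' β := by
    intro x hx
    rw [mem_roots_map h_ne_zero] at hx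
    specialize hc (ιEE' γ - ιEE' (ιFE c) * x) (by
      have f_root := root_left_of_root_gcd hx
      rw [eval₂_comp, eval₂_sub, eval₂_mul, eval₂_C, eval₂_C, eval₂_X, eval₂_map] at f_root
      exact (mem_roots_map (minpoly.ne_zero hα)).mpr f_root)
    specialize hc x (by
      rw [mem_roots_map (minpoly.ne_zero hβ), ← eval₂_map]
      exact root_right_of_root_gcd hx)
    by_contra a
    apply hc
    apply (div_eq_iff (sub_ne_zero.mpr a)).mpr
    simp only [γ, Algebra.smul_def, map_add, map_mul, RingHom.comp_apply]
    ring
  rw [← eq_X_sub_C_of_separable_of_root_eq h_sep h_root h_splits h_roots]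
  trans EuclideanDomain.gcd (?_ : E[X]) (?_ : E[X])
  · dsimp only [γ]
    convert! (gcd_map (algebraMap F⟮γ⟯ E)).symm
  · simp only [map_comp, Polynomial.map_map, ← IsScalarTower.algebraMap_eq, Polynomial.map_sub,
      map_C, AdjoinSimple.algebraMap_gen, Polynomial.map_mul, map_X]
    congr

open Polynomial in
theorem exists_nat_avoid {F : Type*} [Field F] [CharZero F] {E : Type*} [Field E]
    (ϕ : F →+* E) (α β : E) (f g : F[X]) :
    ∃ n : ℕ, n ≤ f.natDegree * g.natDegree ∧
      ∀ α' ∈ (f.map ϕ).roots, ∀ β' ∈ (g.map ϕ).roots,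
        -(α' - α) / (β' - β) ≠ ϕ (n : F) := by
  classical
  let s : Finset E := ((f.map ϕ).roots.toFinset ×ˢ (g.map ϕ).roots.toFinset).image
    fun p => -(p.1 - α) / (p.2 - β)
  let t : Finset E := (Finset.range (f.natDegree * g.natDegree + 1)).image
    fun n : ℕ => ϕ (n : F)
  have hs : s.card ≤ f.natDegree * g.natDegree := by
    refine Finset.card_image_le.trans ?_
    rw [Finset.card_product]
    have key : ∀ q : F[X], (q.map ϕ).roots.toFinset.card ≤ q.natDegree := fun q =>
      (Multiset.toFinset_card_le _).trans ((card_roots' _).trans natDegree_map_le)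
    exact Nat.mul_le_mul (key f) (key g)
  have ht : t.card = f.natDegree * g.natDegree + 1 := by
    rw [show t = (Finset.range (f.natDegree * g.natDegree + 1)).image (ϕ ∘ (Nat.cast : ℕ → F)) from rfl,
      Finset.card_image_of_injective _ (ϕ.injective.comp Nat.cast_injective),
      Finset.card_range]
  obtain ⟨x, hxt, hxs⟩ := Finset.exists_mem_notMem_of_card_lt_card (s := s) (t := t) (by omega)
  obtain ⟨n, hn, rfl⟩ := Finset.mem_image.mp hxt
  refine ⟨n, by simpa [Nat.lt_succ_iff] using hn, fun a ha b hb h => hxs ?_⟩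
  refine Finset.mem_image.mpr ⟨(a, b), ?_, h⟩
  simp only [Finset.mem_product, Multiset.mem_toFinset]
  exact ⟨ha, hb⟩

/-- **Primitive element theorem with a bounded coefficient.**
Let `E` be a field extension of `ℚ` and `α, β ∈ E` algebraic over `ℚ`, with degrees
`d_α = [ℚ(α):ℚ]` and `d_β = [ℚ(β):ℚ]`.  Then there is a natural number
`λ ≤ d_α · d_β` with `ℚ(α + λ·β) = ℚ(α, β)`. -/
theorem primitive_element_bounded {E : Type*} [Field E] [Algebra ℚ E]
    (α β : E) (hα : IsAlgebraic ℚ α) (hβ : IsAlgebraic ℚ β) :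
    ∃ lam : ℕ,
      lam ≤ Module.finrank ℚ (IntermediateField.adjoin ℚ {α}) *
          Module.finrank ℚ (IntermediateField.adjoin ℚ {β}) ∧
        IntermediateField.adjoin ℚ {α + (lam : E) * β} =
          IntermediateField.adjoin ℚ {α, β} := by
  have hα' := hα.isIntegral
  have hβ' := hβ.isIntegral
  rw [IntermediateField.adjoin.finrank hα', IntermediateField.adjoin.finrank hβ']
  obtain ⟨n, hn, hc⟩ := exists_nat_avoid
    ((algebraMap E (Polynomial.SplittingField ((minpoly ℚ β).map
      (algebraMap ℚ E)))).comp (algebraMap ℚ E))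
    (algebraMap E _ α) (algebraMap E _ β) (minpoly ℚ α) (minpoly ℚ β)
  refine ⟨n, hn, ?_⟩
  have h := primitive_aux α β hα' hβ' (n : ℚ) hc
  rw [h, Algebra.smul_def, map_natCast]
end

section
/- Let n ≥ 1 and let x₁,…,x_n ∈ ℝ satisfy Σ_{j=1}^n x_j = 0 and x_j ≥ −t for all j, for some t > 0. Then Σ_{j=1}^n x_j² ≤ n(n−1)·t². Moreover this bound is attained, e.g. by x₁ = (n−1)t and x_j = −t for 2 ≤ j ≤ n. -/
/-- Let `x₁, …, x_n` be real numbers with `Σ x_j = 0` and `x_j ≥ −t` for all `j`, for some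
`t > 0`.  Then `Σ x_j² ≤ n(n−1)·t²`, and the bound is attained by the sequence with
`x₁ = (n−1)t` and `x_j = −t` for `j ≥ 2` (which satisfies the constraints). -/
theorem zero_sum_sq_bound (n : ℕ) (hn : 1 ≤ n) (t : ℝ) (ht : 0 < t)
    (x : Fin n → ℝ) (hsum : ∑ j, x j = 0) (hlb : ∀ j, -t ≤ x j) :
    (∑ j, x j ^ 2 ≤ (n : ℝ) * ((n : ℝ) - 1) * t ^ 2) ∧
      (∑ j : Fin n, (if j = (⟨0, hn⟩ : Fin n) then ((n : ℝ) - 1) * t else -t) = 0) ∧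
      (∀ j : Fin n, -t ≤ (if j = (⟨0, hn⟩ : Fin n) then ((n : ℝ) - 1) * t else -t)) ∧
      (∑ j : Fin n, (if j = (⟨0, hn⟩ : Fin n) then ((n : ℝ) - 1) * t else -t) ^ 2 =
        (n : ℝ) * ((n : ℝ) - 1) * t ^ 2) := by
  have hn' : (1 : ℝ) ≤ n := by exact_mod_cast hn
  have key : ∀ (a : Fin n) (c d : ℝ),
      ∑ j : Fin n, (if j = a then c else d) = c + ((n : ℝ) - 1) * d := by
    intro a c d
    have h : ∀ j : Fin n, (if j = a then c else d) = d + (if j = a then c - d else 0) := by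
      intro j
      split_ifs <;> ring
    rw [Finset.sum_congr rfl (fun j _ => h j), Finset.sum_add_distrib]
    simp
    ring
  refine ⟨?_, ?_, ?_, ?_⟩
  · have hS : ∑ j, (x j + t) = n * t := by
      rw [Finset.sum_add_distrib, hsum]
      simp
    have hub : ∀ j, x j + t ≤ n * t := by
      intro j
      rw [← hS]
      exact Finset.single_le_sum (f := fun j => x j + t)
        (fun i _ => by have := hlb i; linarith) (Finset.mem_univ j)
    have hj : ∀ j, x j ^ 2 ≤ (n * t - 2 * t) * x j + (n - 1) * t ^ 2 := by
      intro j
      have h1 := hub j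
      have h2 := hlb j
      nlinarith [mul_nonneg (sub_nonneg.2 h1) (by linarith : 0 ≤ x j + t)]
    calc ∑ j, x j ^ 2 ≤ ∑ j, ((n * t - 2 * t) * x j + (n - 1) * t ^ 2) :=
          Finset.sum_le_sum (fun j _ => hj j)
      _ = (n : ℝ) * ((n : ℝ) - 1) * t ^ 2 := by
          rw [Finset.sum_add_distrib, ← Finset.mul_sum, hsum]
          simp
          ring
  · rw [key]
    ring
  · intro j
    split_ifs
    · nlinarith
    · exact le_rfl
  · simp only [ite_pow]
    rw [key]
    ring
end
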